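/- Let k be a field of characteristic zero and G a finite subgroup of GL_d(k) acting on the polynomial ring S = k[x_1,…,x_d], with invariant subring R = S^G. Then G is small if and only if for every height-one prime ideal P of S, setting p = P ∩ R, the extension R_p ⊆ S_P of local rings is unramified; in characteristic zero this is equivalent to: for every height-one prime P of S one has P·S_P = (P ∩ R)·S_P. -/

import Mathlib

open MvPolynomial Matrix

noncomputable section

variable (k : Type) [Field k] (d : ℕ)

/-- The `k`-algebra endomorphism of `S = k[x_1,…,x_d]` induced by a `d × d` matrix `M`,
sending the variable `X i` to the linear form `∑ j, M j i • X j`. -/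
def matAct (M : Matrix (Fin d) (Fin d) k) :
    MvPolynomial (Fin d) k →ₐ[k] MvPolynomial (Fin d) k :=
  aeval fun i => ∑ j, M j i • X j

/-- The invariant subalgebra `R = S^G` of a subgroup `G ≤ GL_d(k)`. -/
def invR (G : Subgroup (GL (Fin d) k)) : Subalgebra k (MvPolynomial (Fin d) k) where
  carrier := {s | ∀ g ∈ G, matAct k d (g : Matrix (Fin d) (Fin d) k) s = s}
  mul_mem' ha hb := fun g hg => by rw [_root_.map_mul, ha g hg, hb g hg]
  add_mem' ha hb := fun g hg => by rw [_root_.map_add, ha g hg, hb g hg]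
  algebraMap_mem' r := fun g hg => (matAct k d _).commutes r

/-- `G ≤ GL_d(k)` is small if it contains no pseudo-reflection (an element `g` with
`rank (g - 1) ≤ 1`) other than the identity. -/
def IsSmall (G : Subgroup (GL (Fin d) k)) : Prop :=
  ∀ g ∈ G, ((g : Matrix (Fin d) (Fin d) k) - 1).rank ≤ 1 → g = 1

/-- The linear form with coefficient vector `u`. -/
def linForm (u : Fin d → k) : MvPolynomial (Fin d) k := ∑ j, u j • X j

theorem linForm_coeff (u : Fin d → k) (j : Fin d) :
    coeff (Finsupp.single j 1) (linForm k d u) = u j := by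
  classical
  simp [linForm, coeff_sum, coeff_smul, coeff_X, Finsupp.single_left_inj]

theorem linForm_totalDegree_le (u : Fin d → k) : (linForm k d u).totalDegree ≤ 1 := by
  refine totalDegree_finsetSum_le fun j _ => ?_
  exact (totalDegree_smul_le _ _).trans (by simp)

theorem linForm_totalDegree (u : Fin d → k) (h : linForm k d u ≠ 0) :
    (linForm k d u).totalDegree = 1 := by
  refine le_antisymm (linForm_totalDegree_le k d u) ?_
  by_contra hlt
  have h0 : (linForm k d u).totalDegree = 0 := by omega
  rw [totalDegree_eq_zero_iff_eq_C] at h0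
  apply h
  have hu : ∀ j, u j = 0 := fun j => by
    rw [← linForm_coeff k d u j, h0, coeff_C, if_neg]
    intro h
    simpa using DFunLike.congr_fun h j
  simp [linForm, hu]

theorem linForm_prime (u : Fin d → k) (h : linForm k d u ≠ 0) : Prime (linForm k d u) := by
  refine Irreducible.prime (irreducible_of_totalDegree_eq_one (linForm_totalDegree k d u h) ?_)
  intro x hx
  rw [isUnit_iff_ne_zero]
  rintro rfl
  apply h
  ext i
  simpa using hx i

theorem matAct_X (M : Matrix (Fin d) (Fin d) k) (i : Fin d) :
    matAct k d M (X i) = linForm k d (fun j => M j i) := by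
  simp [matAct, linForm]

theorem matAct_mul (M N : Matrix (Fin d) (Fin d) k) (f : MvPolynomial (Fin d) k) :
    matAct k d (M * N) f = matAct k d M (matAct k d N f) := by
  rw [← AlgHom.comp_apply]
  congr 1
  apply MvPolynomial.algHom_ext
  intro i
  rw [AlgHom.comp_apply, matAct_X, matAct_X]
  simp only [linForm, map_sum, map_smul, matAct_X, Matrix.mul_apply, Finset.smul_sum,
    Finset.sum_smul]
  rw [Finset.sum_comm]
  refine Finset.sum_congr rfl fun a _ => Finset.sum_congr rfl fun b _ => ?_
  rw [smul_smul, mul_comm]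

theorem matAct_one (f : MvPolynomial (Fin d) k) : matAct k d 1 f = f := by
  have : matAct k d 1 = AlgHom.id k _ := by
    apply MvPolynomial.algHom_ext
    intro i
    simp [matAct_X, linForm, Matrix.one_apply]
  rw [this]; rfl

theorem matAct_sub_X (M : Matrix (Fin d) (Fin d) k) (i : Fin d) :
    matAct k d M (X i) - X i = linForm k d (fun j => (M - 1) j i) := by
  have h1 : (X i : MvPolynomial (Fin d) k) = linForm k d (fun j => (1 : Matrix _ _ k) j i) := by
    rw [← matAct_X, matAct_one]
  conv_lhs => rw [h1]
  rw [← h1, matAct_X]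
  simp [linForm, sub_smul]
  exact h1

/-- If all `M x_i - x_i` lie in a principal prime, then `M` is a pseudo-reflection. -/
theorem rank_le_of_inertia (M : Matrix (Fin d) (Fin d) k) (p : MvPolynomial (Fin d) k)
    (hp : Prime p) (h : ∀ i, p ∣ matAct k d M (X i) - X i) : (M - 1).rank ≤ 1 := by
  by_cases hz : M - 1 = 0
  · rw [hz, Matrix.rank_zero]; exact zero_le_one
  simp only [matAct_sub_X] at h
  have key : ∀ i, ∃ c : k, linForm k d (fun j => (M - 1) j i) = p * C c := by
    intro i
    obtain ⟨q, hq⟩ := h i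
    by_cases h0 : linForm k d (fun j => (M - 1) j i) = 0
    · exact ⟨0, by simpa using h0⟩
    have hq0 : q ≠ 0 := by rintro rfl; exact h0 (by rw [hq, mul_zero])
    have hd := linForm_totalDegree k d _ h0
    rw [hq, totalDegree_mul_of_isDomain hp.ne_zero hq0] at hd
    have hpd : p.totalDegree ≠ 0 := by
      intro hp0
      rw [totalDegree_eq_zero_iff_eq_C] at hp0
      apply hp.not_isUnit
      rw [hp0]
      apply IsUnit.map
      rw [isUnit_iff_ne_zero]
      intro hc
      rw [hc] at hp0
      exact hp.ne_zero (by simpa using hp0)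
    have hqd : q.totalDegree = 0 := by omega
    rw [totalDegree_eq_zero_iff_eq_C] at hqd
    exact ⟨_, by rw [← hqd]; exact hq⟩
  choose c hc using key
  have : M - 1 = vecMulVec (fun j => coeff (Finsupp.single j 1) p) c := by
    ext j i
    rw [vecMulVec_apply, mul_comm, ← coeff_C_mul, mul_comm, ← hc, linForm_coeff]
  rw [this]
  exact rank_vecMulVec_le _ _

theorem exists_vecMulVec_of_rank_le (A : Matrix (Fin d) (Fin d) k) (h : A.rank ≤ 1) :
    ∃ u v, A = vecMulVec u v := by
  rw [Matrix.rank, finrank_le_one_iff] at h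
  obtain ⟨u, hu⟩ := h
  choose c hc using fun i => hu ⟨A.mulVecLin (Pi.single i 1), LinearMap.mem_range_self _ _⟩
  refine ⟨u, c, ?_⟩
  ext j i
  have := congrFun (congrArg Subtype.val (hc i)) j
  simp at this
  rw [vecMulVec_apply, ← this, mul_comm]

theorem pow_eq_of_sq_zero (M : Matrix (Fin d) (Fin d) k) (h : (M - 1) * (M - 1) = 0) (n : ℕ) :
    M ^ n = 1 + n • (M - 1) := by
  induction n with
  | zero => simp
  | succ n ih =>
    have h2 : (M - 1) * M = M - 1 := by
      have : (M - 1) * M = (M - 1) * (M - 1) + (M - 1) := by noncomm_ring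
      rw [this, h, zero_add]
    rw [pow_succ, ih, add_mul, smul_mul_assoc, h2, succ_nsmul, one_mul]
    abel

theorem small_of_unram [CharZero k] (G : Subgroup (GL (Fin d) k)) [Fintype G]
    (H : ∀ (P : Ideal (MvPolynomial (Fin d) k)) (hP : P.IsPrime),
        Order.height (⟨P, hP⟩ : PrimeSpectrum (MvPolynomial (Fin d) k)) = 1 →
        Ideal.map
            (algebraMap (MvPolynomial (Fin d) k)
              (Localization (@Ideal.primeCompl _ _ P hP))) P =
          Ideal.map
            ((algebraMap (MvPolynomial (Fin d) k)
                (Localization (@Ideal.primeCompl _ _ P hP))).comp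
              (algebraMap ↥(invR k d G) (MvPolynomial (Fin d) k)))
            (P.comap (algebraMap ↥(invR k d G) (MvPolynomial (Fin d) k)))) :
    IsSmall k d G := by
  intro g hg hr
  by_contra hne
  have hM : (g : Matrix (Fin d) (Fin d) k) - 1 ≠ 0 := by
    intro h0
    exact hne (Units.ext (sub_eq_zero.mp h0))
  obtain ⟨u, v, huv⟩ := exists_vecMulVec_of_rank_le k d _ hr
  set M : Matrix (Fin d) (Fin d) k := (g : Matrix (Fin d) (Fin d) k) with hMdef
  set l := linForm k d u with hl
  have hl0 : l ≠ 0 := by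
    intro h0
    apply hM
    rw [huv]
    ext j i
    rw [vecMulVec_apply, ← linForm_coeff k d u j, ← hl, h0]
    simp
  have hlp : Prime l := linForm_prime k d u hl0
  have hX : ∀ i, matAct k d M (X i) = X i + v i • l := by
    intro i
    rw [← sub_eq_iff_eq_add', matAct_sub_X, huv]
    simp [linForm, hl, vecMulVec_apply, Finset.smul_sum, smul_smul, mul_comm]
  set c : k := ∑ i, u i * v i with hc
  have hact_l : matAct k d M l = l + c • l := by
    conv_lhs => rw [hl, linForm]
    simp only [map_sum, map_smul, hX, smul_add, Finset.sum_add_distrib, smul_smul]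
    rw [hc, Finset.sum_smul]; rfl
  have hc0 : c ≠ 0 := by
    intro hc0
    have hsq : (M - 1) * (M - 1) = 0 := by
      rw [huv]
      ext a b
      have : ∑ x, u a * v x * (u x * v b) = u a * v b * c := by
        rw [hc, Finset.mul_sum]
        exact Finset.sum_congr rfl fun x _ => by ring
      simp [Matrix.mul_apply, vecMulVec_apply, this, hc0]
    have hn := pow_eq_of_sq_zero k d M hsq (Fintype.card G)
    have hg1 : g ^ Fintype.card G = 1 := by
      have := pow_card_eq_one (x := (⟨g, hg⟩ : G))
      exact congrArg Subtype.val this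
    have hM1 : M ^ Fintype.card G = 1 := by
      rw [hMdef, ← Units.val_pow_eq_pow_val, hg1]; rfl
    rw [hM1] at hn
    have h2 : Fintype.card G • (M - 1) = 0 := by simpa using hn
    rw [← Nat.cast_smul_eq_nsmul k, smul_eq_zero] at h2
    rcases h2 with h2 | h2
    · exact Fintype.card_ne_zero (Nat.cast_eq_zero.mp h2)
    · exact hM h2
  have hmod : ∀ f, l ∣ matAct k d M f - f := by
    intro f
    have : (Ideal.Quotient.mkₐ k (Ideal.span {l})).comp (matAct k d M) =
        Ideal.Quotient.mkₐ k (Ideal.span {l}) := by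
      apply MvPolynomial.algHom_ext
      intro i
      rw [AlgHom.comp_apply, hX]
      simp only [Ideal.Quotient.mkₐ_eq_mk]
      rw [Ideal.Quotient.mk_eq_mk_iff_sub_mem, Ideal.mem_span_singleton, add_sub_cancel_left]
      rw [MvPolynomial.smul_eq_C_mul]
      exact Dvd.intro_left _ rfl
    have := DFunLike.congr_fun this f
    rw [AlgHom.comp_apply] at this
    simp only [Ideal.Quotient.mkₐ_eq_mk] at this
    rwa [Ideal.Quotient.mk_eq_mk_iff_sub_mem, Ideal.mem_span_singleton] at this
  have hPp : (Ideal.span {l}).IsPrime := (Ideal.span_singleton_prime hl0).mpr hlp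
  have hht : Order.height (⟨Ideal.span {l}, hPp⟩ : PrimeSpectrum (MvPolynomial (Fin d) k)) = 1 := by
    rw [← PrimeSpectrum.height_eq_orderHeight]
    exact Ideal.height_span_singleton_eq_one_of_mem_nonZeroDivisors
      (mem_nonZeroDivisors_of_ne_zero hl0) hlp.not_isUnit
  have HP := H _ hPp hht
  have hle : Ideal.map
            ((algebraMap (MvPolynomial (Fin d) k)
                (Localization (@Ideal.primeCompl _ _ _ hPp))).comp
              (algebraMap ↥(invR k d G) (MvPolynomial (Fin d) k)))
            ((Ideal.span {l}).comap (algebraMap ↥(invR k d G) (MvPolynomial (Fin d) k))) ≤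
      Ideal.map (algebraMap (MvPolynomial (Fin d) k)
                (Localization (@Ideal.primeCompl _ _ _ hPp))) (Ideal.span {l * l}) := by
    rw [Ideal.map_le_iff_le_comap]
    intro f hf
    rw [Ideal.mem_comap, Ideal.mem_span_singleton] at hf
    rw [Ideal.mem_comap, RingHom.comp_apply]
    apply Ideal.mem_map_of_mem
    have hinv : matAct k d M (f : MvPolynomial (Fin d) k) = f := f.2 g hg
    change l ∣ (f : MvPolynomial (Fin d) k) at hf
    change (f : MvPolynomial (Fin d) k) ∈ _
    obtain ⟨h, hh⟩ := hf
    rw [hh] at hinv ⊢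
    rw [_root_.map_mul, hact_l, MvPolynomial.smul_eq_C_mul] at hinv
    have h3 : (1 + C c) * matAct k d M h = h := by
      apply mul_left_cancel₀ hl0
      rw [← hinv]
      have : (l + C c * l) * matAct k d M h = l * h := hinv
      linear_combination this - hinv
    obtain ⟨q, hq⟩ := hmod h
    have h4 : l ∣ C c * h := ⟨-((1 + C c) * q), by linear_combination (-1 : MvPolynomial (Fin d) k) * (1 + C c) * hq + h3⟩
    have h5 : l ∣ h := by
      have : h = C c⁻¹ * (C c * h) := by
        rw [← mul_assoc, ← C_mul, inv_mul_cancel₀ hc0, C_1, one_mul]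
      rw [this]
      exact h4.mul_left _
    rw [Ideal.mem_span_singleton]
    exact mul_dvd_mul_left l h5
  have hmem : algebraMap (MvPolynomial (Fin d) k)
                (Localization (@Ideal.primeCompl _ _ _ hPp)) l ∈
      Ideal.map (algebraMap (MvPolynomial (Fin d) k)
                (Localization (@Ideal.primeCompl _ _ _ hPp))) (Ideal.span {l * l}) := by
    apply hle
    rw [← HP]
    exact Ideal.mem_map_of_mem _ (Ideal.mem_span_singleton_self l)
  rw [IsLocalization.algebraMap_mem_map_algebraMap_iff (Ideal.primeCompl (Ideal.span {l}))] at hmem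
  obtain ⟨s, hs, hsl⟩ := hmem
  apply hs
  rw [Ideal.mem_span_singleton] at hsl
  change s ∈ Ideal.span {l}
  rw [Ideal.mem_span_singleton]
  exact (mul_dvd_mul_iff_right hl0).mp hsl

/-- Triviality of the inertia group at `p` gives unramifiedness. -/
theorem exists_mul_mem (G : Subgroup (GL (Fin d) k)) [Fintype G]
    (p : MvPolynomial (Fin d) k) (hp : Prime p)
    (hI : ∀ g : G, g ≠ 1 → ∃ a, ¬ p ∣ matAct k d (g : GL (Fin d) k) a - a) :
    ∃ s, ¬ p ∣ s ∧ s * p ∈ Ideal.map (algebraMap ↥(invR k d G) (MvPolynomial (Fin d) k))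
      ((Ideal.span {p}).comap (algebraMap ↥(invR k d G) (MvPolynomial (Fin d) k))) := by
  classical
  let σ : G → MvPolynomial (Fin d) k →ₐ[k] MvPolynomial (Fin d) k :=
    fun g => matAct k d ((g : GL (Fin d) k) : Matrix (Fin d) (Fin d) k)
  have σmul : ∀ g h f, σ (g * h) f = σ g (σ h f) := fun g h f => by
    simp only [σ, Subgroup.coe_mul, Units.val_mul, matAct_mul]
  have σone : ∀ f, σ 1 f = f := fun f => by
    simp only [σ, Subgroup.coe_one, Units.val_one, matAct_one]
  set J := Ideal.map (algebraMap ↥(invR k d G) (MvPolynomial (Fin d) k))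
      ((Ideal.span {p}).comap (algebraMap ↥(invR k d G) (MvPolynomial (Fin d) k))) with hJ
  have hdec : ∀ g : G, p ∣ σ g⁻¹ p → p ∣ σ g p := by
    intro g h
    have hpow : ∀ n : ℕ, p ∣ σ (g⁻¹ ^ n) p := by
      intro n
      induction n with
      | zero => rw [pow_zero, σone]
      | succ n ih =>
        rw [pow_succ', σmul]
        exact h.trans (map_dvd (σ g⁻¹) ih)
    have := hpow (Fintype.card G - 1)
    have he : g⁻¹ ^ (Fintype.card G - 1) = g := by
      have h1 : g⁻¹ ^ (Fintype.card G - 1) * g⁻¹ = 1 := by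
        rw [← pow_succ, Nat.sub_add_cancel Fintype.card_pos, pow_card_eq_one]
      simpa using mul_eq_one_iff_eq_inv.mp h1
    rwa [he] at this
  let c : MvPolynomial (Fin d) k :=
    ∏ g ∈ Finset.univ.filter (fun g : G => ¬ p ∣ σ g p), σ g⁻¹ p
  have hc : ¬ p ∣ c := by
    intro h
    obtain ⟨g, hg, hgd⟩ := (Prime.dvd_finsetProd_iff hp _).mp h
    exact (Finset.mem_filter.mp hg).2 (hdec g hgd)
  have hcp : ∀ g, p ∣ σ g (c * p) := by
    intro g
    rw [_root_.map_mul]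
    by_cases h : p ∣ σ g p
    · exact h.mul_left _
    · apply Dvd.dvd.mul_right
      have h1 : σ g⁻¹ p ∣ c := Finset.dvd_prod_of_mem (fun g => σ g⁻¹ p)
        (Finset.mem_filter.mpr ⟨Finset.mem_univ g, h⟩)
      have h2 := map_dvd (σ g) h1
      rwa [← σmul, mul_inv_cancel, σone] at h2
  have htr : ∀ y, ∑ h : G, σ h (c * p) * σ h y ∈ J := by
    intro y
    have hinv : ∑ h : G, σ h (c * p) * σ h y ∈ invR k d G := by
      intro g hg
      change σ ⟨g, hg⟩ _ = _
      simp only [← _root_.map_mul, map_sum, ← σmul]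
      exact Fintype.sum_equiv (Equiv.mulLeft (⟨g, hg⟩ : G)) _ _ fun x => rfl
    have : (algebraMap ↥(invR k d G) (MvPolynomial (Fin d) k)) ⟨_, hinv⟩ ∈ J := by
      apply Ideal.mem_map_of_mem
      rw [Ideal.mem_comap, Ideal.mem_span_singleton]
      change p ∣ ∑ h : G, σ h (c * p) * σ h y
      exact Finset.dvd_sum fun h _ => (hcp h).mul_right _
    exact this
  choose! a ha using hI
  have key : ∀ T : Finset G, ∀ y,
      ∑ h : G, (∏ g ∈ T, (σ h (a g) - σ g (a g))) * (σ h (c * p) * σ h y) ∈ J := by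
    intro T
    induction T using Finset.induction_on with
    | empty => simpa using htr
    | insert b T hb ih =>
      intro y
      have h1 := ih (a b * y)
      have h2 := J.mul_mem_left (σ b (a b)) (ih y)
      have h3 := J.sub_mem h1 h2
      rw [Finset.mul_sum, ← Finset.sum_sub_distrib] at h3
      convert h3 using 1
      refine Finset.sum_congr rfl fun h _ => ?_
      rw [Finset.prod_insert hb, _root_.map_mul (σ h) (a b) y]
      ring
  have hfin := key (Finset.univ.erase 1) 1
  rw [Finset.sum_eq_single (1 : G)] at hfin
  · refine ⟨(∏ g ∈ Finset.univ.erase (1 : G), (σ 1 (a g) - σ g (a g))) * c, ?_, ?_⟩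
    · intro h
      rcases hp.dvd_or_dvd h with h | h
      · obtain ⟨g, hg, hgd⟩ := (Prime.dvd_finsetProd_iff hp _).mp h
        rw [σone, dvd_sub_comm] at hgd
        exact ha g (Finset.ne_of_mem_erase hg) hgd
      · exact hc h
    · simpa only [σone, mul_one, mul_assoc] using hfin
  · intro h _ hne
    rw [Finset.prod_eq_zero (Finset.mem_erase.mpr ⟨hne, Finset.mem_univ h⟩) (sub_self _), zero_mul]
  · simp

theorem unram_of_small (G : Subgroup (GL (Fin d) k)) [Fintype G] (hG : IsSmall k d G)
    (P : Ideal (MvPolynomial (Fin d) k)) (hP : P.IsPrime)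
    (hht : Order.height (⟨P, hP⟩ : PrimeSpectrum (MvPolynomial (Fin d) k)) = 1) :
        Ideal.map
            (algebraMap (MvPolynomial (Fin d) k)
              (Localization (@Ideal.primeCompl _ _ P hP))) P =
          Ideal.map
            ((algebraMap (MvPolynomial (Fin d) k)
                (Localization (@Ideal.primeCompl _ _ P hP))).comp
              (algebraMap ↥(invR k d G) (MvPolynomial (Fin d) k)))
            (P.comap (algebraMap ↥(invR k d G) (MvPolynomial (Fin d) k))) := by
  rw [← PrimeSpectrum.height_eq_orderHeight] at hht
  change P.height = 1 at hht
  have hbot := P.ne_bot_of_height_eq_one hht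
  obtain ⟨p, hp⟩ := UniqueFactorizationMonoid.isPrincipal_of_height_eq_one hht
  change P = Ideal.span {p} at hp
  subst hp
  have hp0 : p ≠ 0 := by
    rintro rfl
    exact hbot (by simp)
  have hpp : Prime p := (Ideal.span_singleton_prime hp0).mp hP
  rw [← Ideal.map_map]
  apply le_antisymm
  · rw [Ideal.map_span, Ideal.span_le, Set.image_singleton, Set.singleton_subset_iff]
    obtain ⟨s, hs, hsp⟩ := exists_mul_mem k d G p hpp (by
      intro g hg
      by_contra! hall
      apply hg
      exact Subtype.ext (hG g g.2 (rank_le_of_inertia k d _ p hpp fun i => hall _)))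
    rw [SetLike.mem_coe,
      IsLocalization.algebraMap_mem_map_algebraMap_iff (Ideal.primeCompl (Ideal.span {p}))]
    exact ⟨s, fun h => hs (Ideal.mem_span_singleton.mp h), hsp⟩
  · exact Ideal.map_mono Ideal.map_comap_le

/-- Proposition 3.14: for a finite subgroup `G ≤ GL_d(k)` (char `k` = 0)
with `R = S^G`, `G` is small if and only if for every height-one prime `P` of `S` the
extension `R_{P∩R} ⊆ S_P` is unramified; in characteristic zero this amounts to
`P·S_P = (P∩R)·S_P` for every height-one prime `P` of `S`. -/
theorem stmt_5 [CharZero k] (G : Subgroup (GL (Fin d) k)) [Fintype G] :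
    IsSmall k d G ↔
      ∀ (P : Ideal (MvPolynomial (Fin d) k)) (hP : P.IsPrime),
        Order.height (⟨P, hP⟩ : PrimeSpectrum (MvPolynomial (Fin d) k)) = 1 →
        Ideal.map
            (algebraMap (MvPolynomial (Fin d) k)
              (Localization (@Ideal.primeCompl _ _ P hP))) P =
          Ideal.map
            ((algebraMap (MvPolynomial (Fin d) k)
                (Localization (@Ideal.primeCompl _ _ P hP))).comp
              (algebraMap ↥(invR k d G) (MvPolynomial (Fin d) k)))
            (P.comap (algebraMap ↥(invR k d G) (MvPolynomial (Fin d) k))) := by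
  exact ⟨fun hG P hP h => unram_of_small k d G hG P hP h, small_of_unram k d G⟩
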